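/- arXiv:1906.01376 — 4 statements merged into one kernel-verified Lean document; each statement's English description precedes it below -/
import Mathlib

section
/- Let X ⊂ ℝ^d, let k : ℝ^d × ℝ^d → ℝ be a symmetric kernel that is Lipschitz continuous with constant L_k in its first argument on X and satisfies |k(z,z′)| ≤ k_max for all z, z′ ∈ X, let x_1,…,x_N ∈ X have symmetric positive semidefinite Gram matrix K, let σ_n² > 0, and assume the posterior variance σ_N²(x) = k(x,x) − k(x,X_N)ᵀ(K + σ_n²I_N)⁻¹k(x,X_N) is nonnegative for all x ∈ X. Then the posterior standard deviation σ_N(x) = √(σ_N²(x)) satisfies, for all x, x′ ∈ X with ‖x − x′‖ ≤ τ, the modulus-of-continuity bound |σ_N(x) − σ_N(x′)| ≤ √( 2τL_k (1 + N ‖(K + σ_n²I_N)⁻¹‖ k_max) ), where ‖(K + σ_n²I_N)⁻¹‖ is the spectral (operator) norm. -/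
open Matrix

/-- Euclidean norm of a vector in `ℝ^N` given as `Fin N → ℝ`. -/
noncomputable def euclNorm {N : ℕ} (v : Fin N → ℝ) : ℝ :=
  Real.sqrt (∑ i, v i ^ 2)

/-- Spectral (ℓ²-operator) norm of a square real matrix. -/
noncomputable def specNorm {N : ℕ} (M : Matrix (Fin N) (Fin N) ℝ) : ℝ :=
  ‖Matrix.toEuclideanCLM (𝕜 := ℝ) M‖

lemma gp_vec_norm_le {N : ℕ} (u : Fin N → ℝ) (p : ℝ) (hp : 0 ≤ p) (hu : ∀ i, |u i| ≤ p) :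
    ‖WithLp.toLp 2 u‖ ≤ Real.sqrt N * p := by
  rw [EuclideanSpace.norm_eq]
  apply Real.sqrt_le_iff.2
  refine ⟨by positivity, ?_⟩
  rw [mul_pow, Real.sq_sqrt (by positivity)]
  calc ∑ i, ‖(WithLp.toLp 2 u) i‖ ^ 2 ≤ ∑ _i : Fin N, p ^ 2 := by
        apply Finset.sum_le_sum
        intro i _
        exact pow_le_pow_left₀ (norm_nonneg _) (hu i) 2
    _ = N * p ^ 2 := by simp

lemma gp_bilin_le {N : ℕ} (M : Matrix (Fin N) (Fin N) ℝ) (u v : Fin N → ℝ) (p q : ℝ)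
    (hp : 0 ≤ p) (hq : 0 ≤ q) (hu : ∀ i, |u i| ≤ p) (hv : ∀ i, |v i| ≤ q) :
    |u ⬝ᵥ (M *ᵥ v)| ≤ N * specNorm M * p * q := by
  have h1 : u ⬝ᵥ (M *ᵥ v) =
      inner ℝ (WithLp.toLp 2 u) (Matrix.toEuclideanCLM (𝕜 := ℝ) M (WithLp.toLp 2 v)) := by
    simp [Matrix.toEuclideanCLM_toLp, EuclideanSpace.inner_toLp_toLp, dotProduct_comm]
  rw [h1]
  have hM : 0 ≤ specNorm M := norm_nonneg _
  calc _ ≤ ‖WithLp.toLp 2 u‖ * ‖Matrix.toEuclideanCLM (𝕜 := ℝ) M (WithLp.toLp 2 v)‖ :=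
        abs_real_inner_le_norm _ _
    _ ≤ (Real.sqrt N * p) * (specNorm M * (Real.sqrt N * q)) := by
        apply mul_le_mul (gp_vec_norm_le u p hp hu) _ (norm_nonneg _) (by positivity)
        exact (ContinuousLinearMap.le_opNorm _ _).trans
          (mul_le_mul_of_nonneg_left (gp_vec_norm_le v q hq hv) hM)
    _ = (Real.sqrt N * Real.sqrt N) * specNorm M * p * q := by ring
    _ = _ := by rw [Real.mul_self_sqrt (by positivity)]

lemma gp_sqrt_sub {a b c : ℝ} (ha : 0 ≤ a) (hb : 0 ≤ b) (h : |a - b| ≤ c) :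
    |Real.sqrt a - Real.sqrt b| ≤ Real.sqrt c := by
  apply Real.abs_le_sqrt
  have h1 := Real.sq_sqrt ha
  have h2 := Real.sq_sqrt hb
  have h3 := Real.sqrt_nonneg a
  have h4 := Real.sqrt_nonneg b
  obtain ⟨h5, h6⟩ := abs_le.1 h
  rcases le_total (Real.sqrt a) (Real.sqrt b) with h7 | h7 <;> nlinarith

/-- **Modulus of continuity of the GP posterior standard deviation.**
For a symmetric kernel, Lipschitz with constant `L_k` in its first argument and bounded
by `k_max` on `X`, with PSD Gram matrix and nonnegative posterior variance, the posterior
standard deviation satisfies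
`|σ_N(x) − σ_N(x')| ≤ √(2 τ L_k (1 + N ‖(K + σ_n² I)⁻¹‖ k_max))`
whenever `‖x − x'‖ ≤ τ`. -/
theorem gp_posterior_stddev_modulus
    {d N : ℕ} (X : Set (EuclideanSpace ℝ (Fin d)))
    (k : EuclideanSpace ℝ (Fin d) → EuclideanSpace ℝ (Fin d) → ℝ)
    (hsym : ∀ x x', k x x' = k x' x)
    (Lk kmax : ℝ)
    (hLip : ∀ x ∈ X, ∀ x' ∈ X, ∀ z, |k x z - k x' z| ≤ Lk * ‖x - x'‖)
    (hbound : ∀ z ∈ X, ∀ z' ∈ X, |k z z'| ≤ kmax)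
    (xs : Fin N → EuclideanSpace ℝ (Fin d)) (hxs : ∀ i, xs i ∈ X)
    (K : Matrix (Fin N) (Fin N) ℝ) (hK : K = Matrix.of fun i j => k (xs i) (xs j))
    (hKpsd : K.PosSemidef)
    (σn2 : ℝ) (hσ : 0 < σn2)
    (var : EuclideanSpace ℝ (Fin d) → ℝ)
    (hvar : ∀ x, var x = k x x -
      (fun i => k x (xs i)) ⬝ᵥ
        ((K + σn2 • (1 : Matrix (Fin N) (Fin N) ℝ))⁻¹ *ᵥ fun i => k x (xs i)))
    (hvar_nonneg : ∀ x ∈ X, 0 ≤ var x)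
    (τ : ℝ) :
    ∀ x ∈ X, ∀ x' ∈ X, ‖x - x'‖ ≤ τ →
      |Real.sqrt (var x) - Real.sqrt (var x')| ≤
        Real.sqrt (2 * τ * Lk *
          (1 + N * specNorm (K + σn2 • (1 : Matrix (Fin N) (Fin N) ℝ))⁻¹ * kmax)) := by
  intro x hx x' hx' hr
  by_cases hxx : x = x'
  · subst hxx
    simp
  apply gp_sqrt_sub (hvar_nonneg x hx) (hvar_nonneg x' hx')
  rw [hvar x, hvar x']
  set M := (K + σn2 • (1 : Matrix (Fin N) (Fin N) ℝ))⁻¹ with hMdef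
  have hM : 0 ≤ specNorm M := norm_nonneg _
  have hpos : 0 < ‖x - x'‖ := norm_pos_iff.2 (sub_ne_zero.2 hxx)
  have hD : 0 ≤ Lk * ‖x - x'‖ := (abs_nonneg _).trans (hLip x hx x' hx' x)
  have hL : 0 ≤ Lk := nonneg_of_mul_nonneg_left hD hpos
  have hk : 0 ≤ kmax := (abs_nonneg _).trans (hbound x hx x hx)
  have hDτ : Lk * ‖x - x'‖ ≤ Lk * τ := mul_le_mul_of_nonneg_left hr hL
  have hT : 0 ≤ Lk * τ := hD.trans hDτ
  set a : Fin N → ℝ := fun i => k x (xs i) with ha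
  set b : Fin N → ℝ := fun i => k x' (xs i) with hb
  have hab : ∀ i, |(a - b) i| ≤ Lk * τ := fun i => (hLip x hx x' hx' (xs i)).trans hDτ
  have e1 := abs_le.1 (gp_bilin_le M (a - b) a _ kmax hT hk hab
    (fun i => hbound x hx _ (hxs i)))
  have e2 := abs_le.1 (gp_bilin_le M b (a - b) kmax _ hk hT
    (fun i => hbound x' hx' _ (hxs i)) hab)
  rw [sub_dotProduct] at e1
  rw [Matrix.mulVec_sub, dotProduct_sub] at e2
  have e3 := abs_le.1 ((hLip x hx x' hx' x).trans hDτ)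
  have e4 := abs_le.1 ((hLip x hx x' hx' x').trans hDτ)
  rw [hsym x' x] at e3
  obtain ⟨e11, e12⟩ := e1
  obtain ⟨e21, e22⟩ := e2
  obtain ⟨e31, e32⟩ := e3
  obtain ⟨e41, e42⟩ := e4
  rw [abs_le]
  constructor <;> nlinarith
end

section
/- Let X ⊂ ℝ^d, let k : ℝ^d × ℝ^d → ℝ be a symmetric kernel that is Lipschitz continuous with constant L_k in its first argument on X, let x_1,…,x_N ∈ X have symmetric positive semidefinite Gram matrix K, and let σ_n² > 0. Then for all x, x′ ∈ X the posterior variance σ_N²(x) = k(x,x) − k(x,X_N)ᵀ(K + σ_n²I_N)⁻¹k(x,X_N) satisfies |σ_N²(x) − σ_N²(x′)| ≤ 2L_k‖x − x′‖ + ‖k(x,X_N) − k(x′,X_N)‖ · ‖(K + σ_n²I_N)⁻¹‖ · ‖k(x,X_N) + k(x′,X_N)‖, where the middle factor is the spectral norm of the matrix (K + σ_n²I_N)⁻¹. -/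
open Matrix

lemma bilin_bound {N : ℕ} (M : Matrix (Fin N) (Fin N) ℝ) (u v : Fin N → ℝ) :
    |u ⬝ᵥ (M *ᵥ v)| ≤ euclNorm u * specNorm M * euclNorm v := by
  have hn : ∀ w : Fin N → ℝ, euclNorm w = ‖WithLp.toLp 2 w‖ := by
    intro w
    simp [euclNorm, EuclideanSpace.norm_eq]
  have h1 : u ⬝ᵥ (M *ᵥ v) = inner ℝ (WithLp.toLp 2 u)
      (Matrix.toEuclideanCLM (𝕜 := ℝ) M (WithLp.toLp 2 v)) := by
    rw [Matrix.toEuclideanCLM_toLp, EuclideanSpace.inner_toLp_toLp, dotProduct_comm]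
    simp
  rw [h1, hn, hn, specNorm, mul_assoc]
  exact (abs_real_inner_le_norm _ _).trans
    (mul_le_mul_of_nonneg_left (ContinuousLinearMap.le_opNorm _ _) (norm_nonneg _))

/-- **Continuity bound for the GP posterior variance.**
`|σ_N²(x) − σ_N²(x')| ≤ 2 L_k ‖x − x'‖ + ‖k(x,X_N) − k(x',X_N)‖ ‖(K + σ_n² I)⁻¹‖ ‖k(x,X_N) + k(x',X_N)‖`. -/
theorem gp_posterior_variance_continuity
    {d N : ℕ} (X : Set (EuclideanSpace ℝ (Fin d)))
    (k : EuclideanSpace ℝ (Fin d) → EuclideanSpace ℝ (Fin d) → ℝ)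
    (hsym : ∀ x x', k x x' = k x' x)
    (Lk : ℝ)
    (hLip : ∀ x ∈ X, ∀ x' ∈ X, ∀ z, |k x z - k x' z| ≤ Lk * ‖x - x'‖)
    (xs : Fin N → EuclideanSpace ℝ (Fin d)) (hxs : ∀ i, xs i ∈ X)
    (K : Matrix (Fin N) (Fin N) ℝ) (hK : K = Matrix.of fun i j => k (xs i) (xs j))
    (hKpsd : K.PosSemidef)
    (σn2 : ℝ) (hσ : 0 < σn2)
    (var : EuclideanSpace ℝ (Fin d) → ℝ)
    (hvar : ∀ x, var x = k x x -
      (fun i => k x (xs i)) ⬝ᵥ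
        ((K + σn2 • (1 : Matrix (Fin N) (Fin N) ℝ))⁻¹ *ᵥ fun i => k x (xs i))) :
    ∀ x ∈ X, ∀ x' ∈ X,
      |var x - var x'| ≤
        2 * Lk * ‖x - x'‖ +
          euclNorm (fun i => k x (xs i) - k x' (xs i)) *
            specNorm (K + σn2 • (1 : Matrix (Fin N) (Fin N) ℝ))⁻¹ *
            euclNorm (fun i => k x (xs i) + k x' (xs i)) := by
  intro x hx x' hx'
  have hM : ((K + σn2 • (1 : Matrix (Fin N) (Fin N) ℝ))⁻¹)ᵀ
      = (K + σn2 • (1 : Matrix (Fin N) (Fin N) ℝ))⁻¹ := by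
    have hKt : Kᵀ = K := by
      rw [hK]
      ext i j
      exact hsym _ _
    rw [Matrix.transpose_nonsing_inv, Matrix.transpose_add, Matrix.transpose_smul,
      Matrix.transpose_one, hKt]
  rw [hvar, hvar]
  generalize (K + σn2 • (1 : Matrix (Fin N) (Fin N) ℝ))⁻¹ = M at hM ⊢
  have hb := bilin_bound M (fun i => k x (xs i) - k x' (xs i)) (fun i => k x (xs i) + k x' (xs i))
  have e : (fun i => k x (xs i) - k x' (xs i)) ⬝ᵥ (M *ᵥ (fun i => k x (xs i) + k x' (xs i)))
      = (fun i => k x (xs i)) ⬝ᵥ (M *ᵥ fun i => k x (xs i))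
        - (fun i => k x' (xs i)) ⬝ᵥ (M *ᵥ fun i => k x' (xs i)) := by
    generalize ha : (fun i => k x (xs i)) = a
    generalize hb' : (fun i => k x' (xs i)) = b
    have h1 : (fun i => k x (xs i) - k x' (xs i)) = a - b := by rw [← ha, ← hb']; rfl
    have h2 : (fun i => k x (xs i) + k x' (xs i)) = a + b := by rw [← ha, ← hb']; rfl
    have h3 : a ⬝ᵥ (M *ᵥ b) = b ⬝ᵥ (M *ᵥ a) := by
      rw [Matrix.dotProduct_mulVec, ← Matrix.mulVec_transpose, hM, dotProduct_comm]
    rw [h1, h2, Matrix.mulVec_add, sub_dotProduct, dotProduct_add, dotProduct_add, h3]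
    ring
  rw [e] at hb
  have l1 := hLip x hx x' hx' x
  have l2 := hLip x hx x' hx' x'
  rw [hsym x' x] at l1
  rw [abs_le] at *
  constructor <;> linarith [l1.1, l1.2, l2.1, l2.2, hb.1, hb.2]
end

section
/- Let X ⊂ ℝ^d be contained in a hypercube of edge length r > 0, and let k : ℝ^d × ℝ^d → ℝ be a symmetric kernel that is Lipschitz continuous with constant L_k > 0 in its first argument on the hypercube, with k(x,x) + k(x′,x′) − 2k(x,x′) ≥ 0 there. Then for every ϱ > 0 there exists a finite set C contained in the hypercube with cardinality at most (1 + 4√d · r · L_k / ϱ²)^d such that for every x ∈ X there is c ∈ C with d_k(x,c) ≤ ϱ/2, where d_k(x,x′) = √(k(x,x) + k(x′,x′) − 2k(x,x′)) is the covariance pseudo-metric. -/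
lemma exists_grid_index (n : ℕ) (hn : 0 < n) (r t : ℝ) (hr : 0 < r) (h0 : 0 ≤ t) (h1 : t ≤ r) :
    ∃ j : Fin n, |t - r * (2 * (j : ℕ) + 1) / (2 * n)| ≤ r / (2 * n) := by
  have hn' : (0 : ℝ) < n := by exact_mod_cast hn
  have key : ∃ j : Fin n, ((j : ℕ) : ℝ) ≤ n * t / r ∧ n * t / r ≤ (j : ℕ) + 1 := by
    have hs0 : 0 ≤ n * t / r := by positivity
    by_cases hs : n * t / r < n
    · exact ⟨⟨⌊n * t / r⌋₊, (Nat.floor_lt hs0).2 hs⟩, Nat.floor_le hs0,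
        (Nat.lt_floor_add_one _).le⟩
    · refine ⟨⟨n - 1, by omega⟩, ?_, ?_⟩
      · push Not at hs
        have : ((n - 1 : ℕ) : ℝ) ≤ n := by exact_mod_cast Nat.sub_le n 1
        exact this.trans hs
      · have : ((n - 1 : ℕ) : ℝ) + 1 = n := by exact_mod_cast Nat.sub_add_cancel hn
        simp only [this]
        rw [div_le_iff₀ hr]
        gcongr
  obtain ⟨j, hj1, hj2⟩ := key
  refine ⟨j, ?_⟩
  rw [le_div_iff₀ hr] at hj1
  rw [div_le_iff₀ hr] at hj2
  have e : t - r * (2 * (j : ℕ) + 1) / (2 * n) = (2 * (n * t) - r * (2 * (j : ℕ) + 1)) / (2 * n) := by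
    field_simp
  rw [e, abs_div, abs_of_pos (show (0 : ℝ) < 2 * n by positivity)]
  gcongr
  rw [abs_le]
  constructor <;> nlinarith

lemma euclid_norm_le {d : ℕ} (v : EuclideanSpace ℝ (Fin d)) (b : ℝ) (hb : 0 ≤ b)
    (h : ∀ i, |v i| ≤ b) : ‖v‖ ≤ Real.sqrt d * b := by
  rw [EuclideanSpace.norm_eq]
  have h2 : ∑ i, ‖v i‖ ^ 2 ≤ d * b ^ 2 := by
    calc ∑ i, ‖v i‖ ^ 2 ≤ ∑ _i : Fin d, b ^ 2 := by
          refine Finset.sum_le_sum fun i _ => ?_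
          exact pow_le_pow_left₀ (norm_nonneg _) (h i) 2
      _ = d * b ^ 2 := by simp
  calc Real.sqrt (∑ i, ‖v i‖ ^ 2) ≤ Real.sqrt (d * b ^ 2) := Real.sqrt_le_sqrt h2
    _ = Real.sqrt d * b := by rw [Real.sqrt_mul (by positivity), Real.sqrt_sq hb]

/-- **Covering number with respect to the covariance pseudo-metric.**
Let `X` be contained in a hypercube of edge length `r > 0` and let `k` be a symmetric
kernel that is Lipschitz with constant `L_k > 0` in its first argument on the hypercube,
with `k(x,x) + k(x',x') − 2k(x,x') ≥ 0` there. Then for every `ϱ > 0` there is a finite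
set `C` in the hypercube of cardinality at most `(1 + 4√d·r·L_k/ϱ²)^d` such that every
`x ∈ X` is within covariance pseudo-distance `ϱ/2` of some point of `C`. -/
theorem covariance_pseudometric_covering
    {d : ℕ} (X : Set (EuclideanSpace ℝ (Fin d)))
    (z : EuclideanSpace ℝ (Fin d)) (r : ℝ) (hr : 0 < r)
    (H : Set (EuclideanSpace ℝ (Fin d)))
    (hH : H = {x | ∀ i, x i ∈ Set.Icc (z i) (z i + r)})
    (hXH : X ⊆ H)
    (k : EuclideanSpace ℝ (Fin d) → EuclideanSpace ℝ (Fin d) → ℝ)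
    (hsym : ∀ x x', k x x' = k x' x)
    (Lk : ℝ) (hLk : 0 < Lk)
    (hLip : ∀ x ∈ H, ∀ x' ∈ H, ∀ w, |k x w - k x' w| ≤ Lk * ‖x - x'‖)
    (hnonneg : ∀ x ∈ H, ∀ x' ∈ H, 0 ≤ k x x + k x' x' - 2 * k x x') :
    ∀ ϱ : ℝ, 0 < ϱ →
      ∃ C : Finset (EuclideanSpace ℝ (Fin d)),
        (∀ c ∈ C, c ∈ H) ∧
        (C.card : ℝ) ≤ (1 + 4 * Real.sqrt d * r * Lk / ϱ ^ 2) ^ d ∧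
        ∀ x ∈ X, ∃ c ∈ C, Real.sqrt (k x x + k c c - 2 * k x c) ≤ ϱ / 2 := by
  classical
  intro ρ hρ
  set a : ℝ := 4 * Real.sqrt d * r * Lk / ρ ^ 2 with ha
  have ha0 : 0 ≤ a := by positivity
  set n := ⌈a⌉₊ with hn
  have hna : a ≤ n := Nat.le_ceil a
  have hna' : (n : ℝ) ≤ 1 + a := by linarith [Nat.ceil_lt_add_one ha0]
  have hnpos : ∀ _ : Fin d, 0 < n := by
    intro i
    have hd : 0 < d := i.pos
    have : (0 : ℝ) < d := by exact_mod_cast hd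
    exact Nat.ceil_pos.2 (by positivity)
  let g : (Fin d → Fin n) → EuclideanSpace ℝ (Fin d) := fun j =>
    WithLp.toLp 2 fun i => z i + r * (2 * ((j i : ℕ) : ℝ) + 1) / (2 * n)
  have hg : ∀ j i, g j i = z i + r * (2 * ((j i : ℕ) : ℝ) + 1) / (2 * n) := fun _ _ => rfl
  have hgH : ∀ j, g j ∈ H := by
    intro j
    rw [hH]
    intro i
    have hn' : (0 : ℝ) < n := by exact_mod_cast hnpos i
    have hj : ((j i : ℕ) : ℝ) + 1 ≤ n := by exact_mod_cast (j i).isLt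
    rw [hg]
    refine ⟨by have : 0 ≤ r * (2 * ((j i : ℕ) : ℝ) + 1) / (2 * n) := by positivity
               linarith, ?_⟩
    have : r * (2 * ((j i : ℕ) : ℝ) + 1) / (2 * n) ≤ r := by
      rw [div_le_iff₀ (by positivity)]
      gcongr
      linarith
    linarith
  refine ⟨Finset.univ.image g, ?_, ?_, ?_⟩
  · intro c hc
    obtain ⟨j, -, rfl⟩ := Finset.mem_image.1 hc
    exact hgH j
  · have h1 : (Finset.univ.image g).card ≤ n ^ d := by
      refine Finset.card_image_le.trans ?_
      simp
    calc ((Finset.univ.image g).card : ℝ) ≤ (n : ℝ) ^ d := by exact_mod_cast h1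
      _ ≤ (1 + a) ^ d := by gcongr
  · intro x hx
    have hxH := hXH hx
    have hxI : ∀ i, x i ∈ Set.Icc (z i) (z i + r) := by
      rw [hH] at hxH
      exact hxH
    have hex : ∀ i, ∃ j : Fin n,
        |(x i - z i) - r * (2 * ((j : ℕ) : ℝ) + 1) / (2 * n)| ≤ r / (2 * n) := fun i =>
      exists_grid_index n (hnpos i) r _ hr (by linarith [(hxI i).1]) (by linarith [(hxI i).2])
    choose j hj using hex
    refine ⟨g j, Finset.mem_image_of_mem g (Finset.mem_univ j), ?_⟩
    have hdist : ‖x - g j‖ ≤ Real.sqrt d * (r / (2 * n)) := by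
      refine euclid_norm_le _ _ (by positivity) fun i => ?_
      have := hj i
      rw [PiLp.sub_apply, hg]
      rwa [← sub_sub]
    have hbound : 2 * Lk * (Real.sqrt d * (r / (2 * n))) ≤ (ρ / 2) ^ 2 := by
      rcases Nat.eq_zero_or_pos n with h0 | h0
      · rw [h0]
        simp
        positivity
      · have hn' : (0 : ℝ) < n := by exact_mod_cast h0
        rw [ha, div_le_iff₀ (by positivity)] at hna
        have e : 2 * Lk * (Real.sqrt d * (r / (2 * n))) = Lk * Real.sqrt d * r / n := by
          field_simp
        rw [e, div_le_iff₀ hn']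
        nlinarith
    have l1 := (abs_le.1 (hLip x hxH (g j) (hgH j) x)).2
    have l2 := (abs_le.1 (hLip x hxH (g j) (hgH j) (g j))).1
    have hs := hsym x (g j)
    refine Real.sqrt_le_iff.2 ⟨by positivity, ?_⟩
    have := mul_le_mul_of_nonneg_left hdist hLk.le
    nlinarith
end

section
/- For all real numbers a > 0 and b > 0, the integral ∫₀^a √(log(1 + b/ϱ²)) dϱ is at most √6 · max{a, √b}. -/
/-- **Bound on the entropy integral.**
For `a, b > 0`, `∫₀^a √(log(1 + b/ϱ²)) dϱ ≤ √6 · max{a, √b}`. -/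
theorem entropy_integral_bound (a b : ℝ) (ha : 0 < a) (hb : 0 < b) :
    ∫ ϱ in (0 : ℝ)..a, Real.sqrt (Real.log (1 + b / ϱ ^ 2)) ≤
      Real.sqrt 6 * max a (Real.sqrt b) := by
  have hs : 0 < √b := Real.sqrt_pos.2 hb
  have hlog : ∀ y : ℝ, 0 ≤ y → Real.log (1 + y ^ 2) ≤ 3 / 2 * y := by
    intro y hy
    rw [Real.log_le_iff_le_exp (by positivity)]
    have := Real.quadratic_le_exp_of_nonneg (x := 3 / 2 * y) (by positivity)
    nlinarith [sq_nonneg y]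
  have hpt : ∀ x : ℝ, 0 < x → √(Real.log (1 + b / x ^ 2)) ≤
      √(3 / 2 * √b) * x ^ (-(1 / 2) : ℝ) := by
    intro x hx
    have h1 := hlog (√b / x) (by positivity)
    rw [div_pow, Real.sq_sqrt hb.le] at h1
    have h2 : √(3 / 2 * √b) * x ^ (-(1 / 2) : ℝ) = √(3 / 2 * (√b / x)) := by
      rw [Real.rpow_neg hx.le, ← Real.sqrt_eq_rpow, ← mul_div_assoc,
        Real.sqrt_div (by positivity), ← div_eq_mul_inv]
    rw [h2]
    exact Real.sqrt_le_sqrt h1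
  have hint : IntervalIntegrable (fun x : ℝ => √(3 / 2 * √b) * x ^ (-(1 / 2) : ℝ))
      MeasureTheory.volume 0 a :=
    (intervalIntegral.intervalIntegrable_rpow' (by norm_num)).const_mul _
  have hle : ∫ ϱ in (0 : ℝ)..a, √(Real.log (1 + b / ϱ ^ 2)) ≤
      ∫ x in (0 : ℝ)..a, √(3 / 2 * √b) * x ^ (-(1 / 2) : ℝ) := by
    rw [intervalIntegral.integral_of_le ha.le, intervalIntegral.integral_of_le ha.le]
    refine MeasureTheory.integral_mono_of_nonneg
      (Filter.Eventually.of_forall fun x => Real.sqrt_nonneg _) hint.1 ?_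
    exact (MeasureTheory.ae_restrict_iff' measurableSet_Ioc).2
      (Filter.Eventually.of_forall fun x hx => hpt x hx.1)
  refine hle.trans ?_
  rw [intervalIntegral.integral_const_mul, integral_rpow (Or.inl (by norm_num))]
  have e : (-(1 / 2) + 1 : ℝ) = 1 / 2 := by norm_num
  rw [e, Real.zero_rpow (by norm_num), ← Real.sqrt_eq_rpow]
  have h6 : √(3 / 2 * √b) * ((√a - 0) / (1 / 2)) = √6 * √(√b * a) := by
    have h4 : (2 : ℝ) = √4 := by
      rw [show (4 : ℝ) = 2 ^ 2 by norm_num, Real.sqrt_sq (by norm_num)]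
    have h5 : √6 = √(3 / 2) * 2 := by
      rw [show (6 : ℝ) = 3 / 2 * 4 by norm_num, Real.sqrt_mul (by norm_num), ← h4]
    rw [Real.sqrt_mul (by norm_num), Real.sqrt_mul hs.le, h5]
    ring
  rw [h6]
  have hm : 0 ≤ max a √b := ha.le.trans (le_max_left _ _)
  refine mul_le_mul_of_nonneg_left ?_ (Real.sqrt_nonneg _)
  rw [Real.sqrt_le_left hm, sq]
  exact mul_le_mul (le_max_right _ _) (le_max_left _ _) ha.le hm
end
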